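/- arXiv:2312.14266 — 4 statements merged into one kernel-verified Lean document; each statement's English description precedes it below -/
import Mathlib

section
/- Let ⟨x,y⟩ := −x₀y₀ + x₁y₁ + x₂y₂ denote the Minkowski bilinear form on ℝ³. Let e₁, e₂, e₃ ∈ ℝ³ and let λ₁, λ₂, λ₃ be nonzero real numbers with λ₁e₁ + λ₂e₂ + λ₃e₃ = 0. Suppose ė₁, ė₂, ė₃ ∈ ℝ³ satisfy ⟨ėᵢ, eᵢ⟩ = 0 for i = 1, 2, 3, together with ⟨ė₁, e₂⟩ + ⟨ė₂, e₁⟩ = 0 and ⟨ė₂, e₃⟩ + ⟨ė₃, e₂⟩ = 0. Then ⟨ė₁, e₃⟩ + ⟨ė₃, e₁⟩ = 0. -/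
/-- The Minkowski bilinear form `⟨x,y⟩ = -x₀y₀ + x₁y₁ + x₂y₂` on `ℝ³`. -/
def minkowski (x y : Fin 3 → ℝ) : ℝ :=
  -(x 0 * y 0) + x 1 * y 1 + x 2 * y 2

/-- If three vectors `e₁, e₂, e₃` satisfy a linear relation with all coefficients nonzero,
and the infinitesimal deformations `de₁, de₂, de₃` preserve at first order the Minkowski
self-pairings and the pairings between the first and second and between the second and
third vectors, then they also preserve at first order the pairing between the first and
third vectors. -/
theorem firstOrder_angle_preserved
    (e₁ e₂ e₃ de₁ de₂ de₃ : Fin 3 → ℝ) (l₁ l₂ l₃ : ℝ)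
    (hl₁ : l₁ ≠ 0) (hl₂ : l₂ ≠ 0) (hl₃ : l₃ ≠ 0)
    (hsum : l₁ • e₁ + l₂ • e₂ + l₃ • e₃ = 0)
    (h1 : minkowski de₁ e₁ = 0) (h2 : minkowski de₂ e₂ = 0) (h3 : minkowski de₃ e₃ = 0)
    (h12 : minkowski de₁ e₂ + minkowski de₂ e₁ = 0)
    (h23 : minkowski de₂ e₃ + minkowski de₃ e₂ = 0) :
    minkowski de₁ e₃ + minkowski de₃ e₁ = 0 := by
  have pairing_relation (x : Fin 3 → ℝ) :
      l₁ * minkowski x e₁ + l₂ * minkowski x e₂ + l₃ * minkowski x e₃ = 0 := by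
    have hc (i : Fin 3) : l₁ * e₁ i + l₂ * e₂ i + l₃ * e₃ i = 0 := by
      simpa using congrFun hsum i
    unfold minkowski
    linear_combination -x 0 * hc 0 + x 1 * hc 1 + x 2 * hc 2
  apply mul_left_cancel₀ (mul_ne_zero hl₁ hl₃)
  linear_combination l₁ * pairing_relation de₁ + l₂ * pairing_relation de₂
    + l₃ * pairing_relation de₃ - l₁ ^ 2 * h1 - l₂ ^ 2 * h2 - l₃ ^ 2 * h3
    - l₁ * l₂ * h12 - l₂ * l₃ * h23
end

section
/- For every ε > 0 and all c₁, c₂ > 0 there exists c₃ > 0 with the following property: if A, B, C are three points of the Euclidean plane ℝ² spanning a triangle whose area (the two-dimensional Lebesgue measure of the convex hull of {A, B, C}) is at most c₁, whose three side lengths dist(A,B), dist(B,C), dist(C,A) are all at least c₂, and at least one of which is at least c₃, then at least one of the three angles ∠BAC, ∠ABC, ∠BCA is at least π − ε. -/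
open EuclideanGeometry MeasureTheory

open scoped Pointwise in
/-- The area of a triangle in the plane is a fixed multiple of the product of two sides and the
sine of the enclosed angle. -/
theorem exists_volume_convexHull_triangle_eq :
    ∃ k : ℝ, 0 < k ∧ ∀ A B C : EuclideanSpace ℝ (Fin 2),
      volume (convexHull ℝ ({A, B, C} : Set (EuclideanSpace ℝ (Fin 2)))) =
        ENNReal.ofReal (Real.sin (∠ B A C) * (dist B A * dist C A) * k) := by
  let b := (EuclideanSpace.basisFun (Fin 2) ℝ).toBasis
  let S : Set (EuclideanSpace ℝ (Fin 2)) := {0, b 0, b 1}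
  have hS : (interior (convexHull ℝ S)).Nonempty := by
    rw [interior_convexHull_nonempty_iff_affineSpan_eq_top,
      AffineSubspace.affineSpan_eq_top_iff_vectorSpan_eq_top_of_nonempty _ _ _ ⟨0, by simp [S]⟩,
      vectorSpan_eq_span_vsub_set_right ℝ (p := 0) (by simp [S]), eq_top_iff, ← b.span_eq]
    refine Submodule.span_mono ?_
    rintro _ ⟨i, rfl⟩
    fin_cases i <;> simp [S]
  have hpos : 0 < volume (convexHull ℝ S) := Measure.measure_pos_of_nonempty_interior _ hS
  have hfin : volume (convexHull ℝ S) ≠ ⊤ :=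
    (Bornology.IsBounded.measure_lt_top
      ((isBounded_convexHull (s := S)).2 (Set.toFinite S).isBounded)).ne
  refine ⟨(volume (convexHull ℝ S)).toReal, ENNReal.toReal_pos hpos.ne' hfin, fun A B C ↦ ?_⟩
  let L : EuclideanSpace ℝ (Fin 2) →ₗ[ℝ] EuclideanSpace ℝ (Fin 2) :=
    b.constr ℝ ![B - A, C - A]
  have himg : convexHull ℝ {A, B, C} = (fun x ↦ A + x) '' (L '' convexHull ℝ S) := by
    have hL : L '' S = {0, B - A, C - A} := by
      simp [S, L, Set.image_insert_eq]
    rw [L.image_convexHull, hL]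
    have h := convexHull_vadd (𝕜 := ℝ) A ({0, B - A, C - A} : Set (EuclideanSpace ℝ (Fin 2)))
    change _ = A +ᵥ convexHull ℝ {0, B - A, C - A}
    rw [← h]
    congr 1
    change _ = (fun x ↦ A + x) '' _
    simp [Set.image_insert_eq]
  have hdet : |LinearMap.det L| = Real.sin (∠ B A C) * (dist B A * dist C A) := by
    rw [EuclideanGeometry.angle, dist_eq_norm_vsub (EuclideanSpace ℝ (Fin 2)) B A,
      dist_eq_norm_vsub (EuclideanSpace ℝ (Fin 2)) C A,
      InnerProductGeometry.sin_angle_mul_norm_mul_norm, ← Real.sqrt_sq_eq_abs,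
      ← LinearMap.det_toMatrix b, Matrix.det_fin_two]
    congr 1
    simp [LinearMap.toMatrix_apply, L, PiLp.inner_apply, b, Fin.sum_univ_two,
      -inner_self_eq_norm_sq_to_K]
    ring
  rw [himg, Set.image_add_left, measure_preimage_add, Measure.addHaar_image_linearMap, hdet,
    ENNReal.ofReal_mul (p := _ * _) (hdet ▸ abs_nonneg (LinearMap.det L)), ENNReal.ofReal_toReal hfin]

section

variable {V P : Type*} [NormedAddCommGroup V] [InnerProductSpace ℝ V] [MetricSpace P]
  [NormedAddTorsor V P]

/-- An angle of a triangle adjacent to a side which is at least as long as the opposite side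
is not obtuse. -/
theorem angle_le_pi_div_two_of_dist_le {A B C : P} (h : dist C A ≤ dist B C) :
    ∠ A B C ≤ Real.pi / 2 := by
  rw [EuclideanGeometry.angle, InnerProductGeometry.angle, Real.arccos_le_pi_div_two]
  refine div_nonneg ?_ (by positivity)
  have h₁ := norm_sub_sq_real (A -ᵥ B) (C -ᵥ B)
  rw [vsub_sub_vsub_cancel_right, ← dist_eq_norm_vsub, ← dist_eq_norm_vsub V C B,
    dist_comm A C, dist_comm C B] at h₁
  have h₂ : dist C A ^ 2 ≤ dist B C ^ 2 := by gcongr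
  nlinarith [sq_nonneg ‖A -ᵥ B‖]

/-- A non-obtuse angle between sides of lengths at least `c` and `d` is small if the product
of its sine with these two lengths is small. -/
theorem angle_le_of_sin_mul_le {A B C : P} {c d D : ℝ} (hc : 0 < c) (hd : 0 < d)
    (hB : ∠ A B C ≤ Real.pi / 2) (hAB : c ≤ dist A B) (hCB : d ≤ dist C B)
    (h : Real.sin (∠ A B C) * (dist A B * dist C B) ≤ D) :
    ∠ A B C ≤ Real.pi / 2 * (D / (c * d)) := by
  have h₁ := Real.mul_le_sin (angle_nonneg A B C) hB
  have hsin : 0 ≤ Real.sin (∠ A B C) := InnerProductGeometry.sin_angle_nonneg _ _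
  have h₂ : Real.sin (∠ A B C) ≤ D / (c * d) := by
    rw [le_div_iff₀ (by positivity)]
    refine le_trans ?_ h
    gcongr
  calc ∠ A B C = Real.pi / 2 * (2 / Real.pi * ∠ A B C) := by field_simp
    _ ≤ _ := by gcongr; exact h₁.trans h₂

/-- If `BC` is a longest side of a triangle, its length is large, the other sides are not too
short and the area is bounded, then the angle opposite to `BC` is close to `π`. -/
theorem pi_sub_le_angle_of_dist_le {A B C : P} {ε c D : ℝ} (hε : 0 < ε) (hc : 0 < c)
    (hD : 0 < D) (hAB : c ≤ dist A B) (hCA : c ≤ dist C A)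
    (hABle : dist A B ≤ dist B C) (hCAle : dist C A ≤ dist B C)
    (hBC : Real.pi * D / (c * ε) ≤ dist B C)
    (hB : Real.sin (∠ A B C) * (dist A B * dist C B) ≤ D)
    (hC : Real.sin (∠ A C B) * (dist A C * dist B C) ≤ D) :
    Real.pi - ε ≤ ∠ B A C := by
  have hd : 0 < Real.pi * D / (c * ε) := by positivity
  have h₁ := angle_le_of_sin_mul_le hc hd (angle_le_pi_div_two_of_dist_le hCAle) hAB
    (dist_comm B C ▸ hBC) hB
  have h₂ := angle_le_of_sin_mul_le hc hd
    (angle_le_pi_div_two_of_dist_le (by rwa [dist_comm B A, dist_comm C B])) (dist_comm C A ▸ hCA)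
    hBC hC
  have h₃ : Real.pi / 2 * (D / (c * (Real.pi * D / (c * ε)))) = ε / 2 := by field_simp
  have hne : B ≠ A := by
    rintro rfl
    simp only [dist_self] at hAB
    linarith
  have hsum := angle_add_angle_add_angle_eq_pi C hne
  rw [angle_comm C, angle_comm B C A] at hsum
  linarith [angle_comm B A C, angle_comm A B C]

end

/-- For every `ε > 0` and `c₁, c₂ > 0` there exists `c₃ > 0` such that every Euclidean
triangle of area at most `c₁`, with all side lengths at least `c₂` and at least one side
length at least `c₃`, has an angle at least `π - ε`. -/
theorem thin_triangle_has_large_angle (ε c₁ c₂ : ℝ) (hε : 0 < ε) (hc₁ : 0 < c₁) (hc₂ : 0 < c₂) :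
    ∃ c₃ : ℝ, 0 < c₃ ∧
      ∀ A B C : EuclideanSpace ℝ (Fin 2),
        AffineIndependent ℝ ![A, B, C] →
        volume (convexHull ℝ ({A, B, C} : Set (EuclideanSpace ℝ (Fin 2)))) ≤ ENNReal.ofReal c₁ →
        c₂ ≤ dist A B → c₂ ≤ dist B C → c₂ ≤ dist C A →
        (c₃ ≤ dist A B ∨ c₃ ≤ dist B C ∨ c₃ ≤ dist C A) →
        (Real.pi - ε ≤ ∠ B A C ∨ Real.pi - ε ≤ ∠ A B C ∨ Real.pi - ε ≤ ∠ B C A) := by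
  obtain ⟨k, hk, hvol⟩ := exists_volume_convexHull_triangle_eq
  have hD : 0 < c₁ / k := by positivity
  refine ⟨Real.pi * (c₁ / k) / (c₂ * ε), by positivity, ?_⟩
  intro A B C _ harea hAB hBC hCA hlong
  have hsin : ∀ X Y Z : EuclideanSpace ℝ (Fin 2), ({Y, X, Z} : Set _) = {A, B, C} →
      Real.sin (∠ X Y Z) * (dist X Y * dist Z Y) ≤ c₁ / k := by
    intro X Y Z h
    rw [← h, hvol, ENNReal.ofReal_le_ofReal_iff hc₁.le] at harea
    rwa [le_div_iff₀ hk]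
  have hA := hsin B A C rfl
  have hA' := hsin C A B (by grind)
  have hB := hsin A B C (by grind)
  have hB' := hsin C B A (by grind)
  have hC := hsin B C A (by grind)
  have hC' := hsin A C B (by grind)
  by_cases hmaxA : dist A B ≤ dist B C ∧ dist C A ≤ dist B C
  · exact .inl <|
      pi_sub_le_angle_of_dist_le hε hc₂ hD hAB hCA hmaxA.1 hmaxA.2 (by grind) hB hC'
  by_cases hmaxB : dist B C ≤ dist C A ∧ dist A B ≤ dist C A
  · exact .inr <| .inl <| angle_comm C B A ▸
      pi_sub_le_angle_of_dist_le hε hc₂ hD hBC hAB hmaxB.1 hmaxB.2 (by grind) hC hA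
  · exact .inr <| .inr <| angle_comm A C B ▸
      pi_sub_le_angle_of_dist_le hε hc₂ hD hCA hBC (by grind) (by grind) (by grind) hA' hB'
end

section
/- Let V be a nonempty finite index set and let A be a real V×V matrix with entries a_{vw} such that a_{vw} ≤ 0 whenever v ≠ w and such that every row sum r_v := ∑_{w ∈ V} a_{vw} is nonnegative. Assume moreover that for every v ∈ V there exists a finite sequence v = v₀, v₁, …, v_k of elements of V with a_{v_j v_{j+1}} ≠ 0 for each 0 ≤ j < k and with r_{v_k} > 0. Then the only vector c ∈ ℝ^V with Ac = 0 is c = 0; in particular, A is invertible. -/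
open Finset

/-- At an index where `c` attains a positive maximum and `A *ᵥ c` is nonpositive, the row sum
vanishes, and `c` attains its maximum at every index joined to it by a nonzero entry. -/
theorem Matrix.row_sum_eq_zero_and_eq_of_isMax {V : Type*} [Fintype V] {A : Matrix V V ℝ}
    {c : V → ℝ} {v : V} (hoff : ∀ w, v ≠ w → A v w ≤ 0) (hrow : 0 ≤ ∑ w, A v w)
    (hc : A.mulVec c v ≤ 0) (hmax : ∀ w, c w ≤ c v) (hpos : 0 < c v) :
    ∑ w, A v w = 0 ∧ ∀ w, A v w ≠ 0 → c w = c v := by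
  have hsplit : A.mulVec c v = c v * ∑ w, A v w + ∑ w, A v w * (c w - c v) := by
    rw [mul_sum, ← sum_add_distrib]
    exact sum_congr rfl fun w _ => by ring
  have hterm : ∀ w ∈ univ, 0 ≤ A v w * (c w - c v) := by
    intro w _
    by_cases hvw : v = w
    · simp [hvw]
    · exact mul_nonneg_of_nonpos_of_nonpos (hoff w hvw) (sub_nonpos.2 (hmax w))
  have hsum := sum_nonneg hterm
  have hprod := mul_nonneg hpos.le hrow
  have hrow_zero : c v * ∑ w, A v w = 0 := by linarith
  have hsum_zero : ∑ w, A v w * (c w - c v) = 0 := by linarith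
  refine ⟨(mul_eq_zero.1 hrow_zero).resolve_left hpos.ne', fun w hw => ?_⟩
  have hw_zero := (sum_eq_zero_iff_of_nonneg hterm).1 hsum_zero w (mem_univ w)
  exact sub_eq_zero.1 ((mul_eq_zero.1 hw_zero).resolve_left hw)

/-- Maximum principle for weakly chained diagonally dominant matrices. -/
theorem Matrix.nonpos_of_mulVec_nonpos_of_weaklyChained {V : Type*} [Fintype V]
    {A : Matrix V V ℝ} (hoff : ∀ v w, v ≠ w → A v w ≤ 0) (hrow : ∀ v, 0 ≤ ∑ w, A v w)
    (hreach : ∀ v : V, ∃ (k : ℕ) (p : ℕ → V), p 0 = v ∧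
        (∀ j < k, A (p j) (p (j + 1)) ≠ 0) ∧ 0 < ∑ w, A (p k) w)
    {c : V → ℝ} (hc : ∀ v, A.mulVec c v ≤ 0) (v : V) : c v ≤ 0 := by
  have : Nonempty V := ⟨v⟩
  obtain ⟨m, hm⟩ := Finite.exists_max c
  refine (hm v).trans (not_lt.1 fun hpos => ?_)
  have hstep : ∀ u, c u = c m → ∑ w, A u w = 0 ∧ ∀ w, A u w ≠ 0 → c w = c u := fun u hu =>
    Matrix.row_sum_eq_zero_and_eq_of_isMax (hoff u) (hrow u) (hc u)
      (fun w => hu ▸ hm w) (hu ▸ hpos)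
  obtain ⟨k, p, hp, hchain, hk⟩ := hreach m
  have hmax : ∀ j ≤ k, c (p j) = c m := by
    intro j
    induction j with
    | zero => exact fun _ => by rw [hp]
    | succ j ih =>
      intro hj
      have hcj := ih (Nat.le_of_succ_le hj)
      exact ((hstep _ hcj).2 _ (hchain j hj)).trans hcj
  exact hk.ne' (hstep _ (hmax k le_rfl)).1

/-- A weakly chained diagonally dominant real matrix (nonpositive off-diagonal entries,
nonnegative row sums, and from each index a chain through nonzero entries reaching an
index with strictly positive row sum) has trivial kernel; in particular it is invertible. -/
theorem weakly_chained_diagonally_dominant_nonsingular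
    {V : Type*} [Fintype V] [DecidableEq V] [Nonempty V]
    (A : Matrix V V ℝ)
    (hoff : ∀ v w, v ≠ w → A v w ≤ 0)
    (hrow : ∀ v, 0 ≤ ∑ w, A v w)
    (hreach : ∀ v : V, ∃ (k : ℕ) (p : ℕ → V), p 0 = v ∧
        (∀ j < k, A (p j) (p (j + 1)) ≠ 0) ∧ 0 < ∑ w, A (p k) w) :
    (∀ c : V → ℝ, A.mulVec c = 0 → c = 0) ∧ IsUnit A := by
  have hker : ∀ c : V → ℝ, A.mulVec c = 0 → c = 0 := by
    intro c hc
    funext v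
    refine le_antisymm
      (Matrix.nonpos_of_mulVec_nonpos_of_weaklyChained hoff hrow hreach (by simp [hc]) v) ?_
    have hneg := Matrix.nonpos_of_mulVec_nonpos_of_weaklyChained hoff hrow hreach
      (c := -c) (by simp [Matrix.mulVec_neg, hc]) v
    simpa using hneg
  refine ⟨hker, Matrix.mulVec_injective_iff_isUnit.1 fun x y hxy => sub_eq_zero.1 (hker _ ?_)⟩
  rw [Matrix.mulVec_sub, sub_eq_zero]
  exact hxy
end

section
/- Let n ≥ 3 and let θ₁ < θ₂ < ⋯ < θₙ < θ₁ + 2π be real numbers such that every consecutive gap lies in the open interval (0, π): setting α_i := θ_{i+1} − θ_i for 1 ≤ i ≤ n−1 and α_n := θ₁ + 2π − θ_n, one has 0 < α_i < π for all i. Define unit vectors u_i := (cos θ_i, sin θ_i) ∈ ℝ². Then, with indices taken modulo n, ∑_{i=1}^{n} ( tan(α_{i−1}/2) + tan(α_i/2) ) · u_i = 0. -/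
/-- The cyclic gap between consecutive angles `θ i`: for `i < n - 1` it is
`θ (i+1) - θ i`, and for the last index it is `θ 0 + 2π - θ i`. -/
noncomputable def cyclicGap {n : ℕ} (θ : Fin n → ℝ) (i : Fin n) : ℝ :=
  if h : (i : ℕ) + 1 < n then θ ⟨(i : ℕ) + 1, h⟩ - θ i
  else θ ⟨0, i.pos⟩ + 2 * Real.pi - θ i

theorem Real.tan_half_mul_cos_add_cos {x a : ℝ} (h : Real.cos (a / 2) ≠ 0) :
    Real.tan (a / 2) * (Real.cos x + Real.cos (x + a)) = Real.sin (x + a) - Real.sin x := by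
  rw [Real.cos_add_cos, Real.sin_sub_sin, Real.tan_eq_sin_div_cos,
    show (x - (x + a)) / 2 = -(a / 2) by ring, show (x + a - x) / 2 = a / 2 by ring,
    show (x + a + x) / 2 = (x + (x + a)) / 2 by ring, Real.cos_neg]
  field_simp

theorem Real.tan_half_mul_sin_add_sin {x a : ℝ} (h : Real.cos (a / 2) ≠ 0) :
    Real.tan (a / 2) * (Real.sin x + Real.sin (x + a)) = Real.cos x - Real.cos (x + a) := by
  have := Real.tan_half_mul_cos_add_cos (x := x - Real.pi / 2) h
  rw [show x - Real.pi / 2 + a = x + a - Real.pi / 2 by ring] at this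
  simp only [Real.cos_sub_pi_div_two, Real.sin_sub_pi_div_two] at this
  linarith

theorem exists_add_cyclicGap {n : ℕ} [NeZero n] (θ : Fin n → ℝ) (i : Fin n) :
    ∃ k : ℤ, θ i + cyclicGap θ i = θ (i + 1) + k * (2 * Real.pi) := by
  unfold cyclicGap
  split_ifs with h
  · have hi : i + 1 = ⟨(i : ℕ) + 1, h⟩ := Fin.ext (Fin.val_add_one_of_lt' h)
    exact ⟨0, by rw [hi]; push_cast; ring⟩
  · have hi : i + 1 = ⟨0, i.pos⟩ := by
      have hn : (i : ℕ) + 1 = n := by omega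
      apply Fin.ext
      simp [Fin.val_add, hn]
    exact ⟨1, by rw [hi]; push_cast; ring⟩

theorem cos_add_cyclicGap {n : ℕ} [NeZero n] (θ : Fin n → ℝ) (i : Fin n) :
    Real.cos (θ i + cyclicGap θ i) = Real.cos (θ (i + 1)) := by
  obtain ⟨k, hk⟩ := exists_add_cyclicGap θ i
  rw [hk, Real.cos_add_int_mul_two_pi]

theorem sin_add_cyclicGap {n : ℕ} [NeZero n] (θ : Fin n → ℝ) (i : Fin n) :
    Real.sin (θ i + cyclicGap θ i) = Real.sin (θ (i + 1)) := by
  obtain ⟨k, hk⟩ := exists_add_cyclicGap θ i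
  rw [hk, Real.sin_add_int_mul_two_pi]

theorem Fin.sum_add_one_eq {M : Type*} [AddCommMonoid M] {n : ℕ} [NeZero n] (f : Fin n → M) :
    ∑ i, f (i + 1) = ∑ i, f i :=
  Equiv.sum_comp (Equiv.addRight (1 : Fin n)) f

theorem Fin.sum_sub_one_add_mul {R : Type*} [CommRing R] {n : ℕ} [NeZero n]
    (t g : Fin n → R) :
    ∑ i, (t (i - 1) + t i) * g i = ∑ i, t i * (g i + g (i + 1)) := by
  have h := Fin.sum_add_one_eq fun i => t (i - 1) * g i
  simp only [add_sub_cancel_right] at h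
  simp only [add_mul, mul_add, Finset.sum_add_distrib, h]
  exact add_comm _ _

/-- For unit vectors `uᵢ = (cos θᵢ, sin θᵢ)` in cyclic order with all consecutive gaps
`αᵢ` in `(0, π)`, one has `∑ᵢ (tan(α_{i-1}/2) + tan(α_i/2)) • uᵢ = 0`. -/
theorem balance_relation_unit_vectors (n : ℕ) [NeZero n] (hn : 3 ≤ n) (θ : Fin n → ℝ)
    (hmono : StrictMono θ)
    (hlast : θ ⟨n - 1, by omega⟩ < θ ⟨0, by omega⟩ + 2 * Real.pi)
    (hgap : ∀ i : Fin n, cyclicGap θ i ∈ Set.Ioo 0 Real.pi) :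
    ∑ i : Fin n,
        (Real.tan (cyclicGap θ (i - 1) / 2) + Real.tan (cyclicGap θ i / 2)) •
          ![Real.cos (θ i), Real.sin (θ i)] = (0 : Fin 2 → ℝ) := by
  have hcos (i : Fin n) : Real.cos (cyclicGap θ i / 2) ≠ 0 := by
    obtain ⟨h₀, h₁⟩ := hgap i
    exact (Real.cos_pos_of_mem_Ioo ⟨by linarith, by linarith⟩).ne'
  ext j
  fin_cases j
  · simp only [Finset.sum_apply, Pi.smul_apply, smul_eq_mul, Fin.zero_eta, Matrix.cons_val_zero,
      Pi.zero_apply]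
    rw [Fin.sum_sub_one_add_mul (fun i => Real.tan (cyclicGap θ i / 2))
      fun i => Real.cos (θ i)]
    simp only [← cos_add_cyclicGap, Real.tan_half_mul_cos_add_cos (hcos _)]
    simp only [sin_add_cyclicGap, Finset.sum_sub_distrib]
    rw [Fin.sum_add_one_eq fun i => Real.sin (θ i), sub_self]
  · simp only [Finset.sum_apply, Pi.smul_apply, smul_eq_mul, Fin.mk_one, Matrix.cons_val_one,
      Matrix.cons_val_fin_one, Pi.zero_apply]
    rw [Fin.sum_sub_one_add_mul (fun i => Real.tan (cyclicGap θ i / 2))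
      fun i => Real.sin (θ i)]
    simp only [← sin_add_cyclicGap, Real.tan_half_mul_sin_add_sin (hcos _)]
    simp only [cos_add_cyclicGap, Finset.sum_sub_distrib]
    rw [Fin.sum_add_one_eq fun i => Real.cos (θ i), sub_self]
end
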